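/- Let n ≥ 2 and m_1 > m_2 > … > m_n > 0. Let Σ = (σ_1,…,σ_N) be a symbolic collision sequence with parameters ρ_1,…,ρ_N > 0 such that for every i ∈ {1,…,n−1} the ball-to-ball collision (i,i+1) occurs in Σ (i.e. i_k = i for some k). Let D = D_{(i_N,ρ_N)} ∘ ⋯ ∘ D_{(i_1,ρ_1)}. Then for every δv ∈ ℝ^n with Σ_j δv_j = 0 and δv ≠ 0, one has Q_1(D(0, δv)) > 0. -/

import Mathlib

open Matrix BigOperators

/-- `γ_i = (m_i - m_{i+1})/(m_i + m_{i+1})` (masses indexed 1-based). -/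
noncomputable def gammaC (m : ℕ → ℝ) (i : ℕ) : ℝ := (m i - m (i + 1)) / (m i + m (i + 1))

/-- `α_i(ρ) = 2 m_i m_{i+1} (m_i - m_{i+1}) ρ / (m_i + m_{i+1})²`. -/
noncomputable def alphaC (m : ℕ → ℝ) (i : ℕ) (ρ : ℝ) : ℝ :=
  2 * m i * m (i + 1) * (m i - m (i + 1)) * ρ / (m i + m (i + 1)) ^ 2

/-- The collision matrix `R_i` (1 ≤ i ≤ n-1); particles are 1-based, so particle `i`
has 0-based index `i - 1` (i.e. `a : Fin n` with `a + 1 = i`).  `R_0 = I`. -/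
noncomputable def Rmat (n : ℕ) (m : ℕ → ℝ) (i : ℕ) : Matrix (Fin n) (Fin n) ℝ :=
  if i = 0 then 1 else
    Matrix.of fun a b =>
      if (a : ℕ) + 1 = i ∧ (b : ℕ) + 1 = i then gammaC m i
      else if (a : ℕ) + 1 = i ∧ (b : ℕ) = i then 1 - gammaC m i
      else if (a : ℕ) = i ∧ (b : ℕ) + 1 = i then 1 + gammaC m i
      else if (a : ℕ) = i ∧ (b : ℕ) = i then -(gammaC m i)
      else if a = b then 1 else 0

/-- The matrix `S_i(ρ)` (zero unless 1 ≤ i ≤ n-1). -/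
noncomputable def Smat (n : ℕ) (m : ℕ → ℝ) (i : ℕ) (ρ : ℝ) : Matrix (Fin n) (Fin n) ℝ :=
  if i = 0 then 0 else
    Matrix.of fun a b =>
      if (a : ℕ) + 1 = i ∧ (b : ℕ) + 1 = i then alphaC m i ρ
      else if (a : ℕ) + 1 = i ∧ (b : ℕ) = i then -(alphaC m i ρ)
      else if (a : ℕ) = i ∧ (b : ℕ) + 1 = i then -(alphaC m i ρ)
      else if (a : ℕ) = i ∧ (b : ℕ) = i then alphaC m i ρ
      else 0

/-- The quadratic form `Q₁(δh, δv) = Σ_j δh_j δv_j`. -/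
noncomputable def Qform (n : ℕ) (x : (Fin n → ℝ) × (Fin n → ℝ)) : ℝ :=
  ∑ j, x.1 j * x.2 j

/-- The collision map `D_{(i,ρ)}`: floor collision when `i = 0`,
ball-to-ball collision `(i, i+1)` when `1 ≤ i ≤ n-1`. -/
noncomputable def Dmap (n : ℕ) (m : ℕ → ℝ) (i : ℕ) (ρ : ℝ)
    (x : (Fin n → ℝ) × (Fin n → ℝ)) : (Fin n → ℝ) × (Fin n → ℝ) :=
  if i = 0 then
    (x.1, fun j => x.2 j + if (j : ℕ) = 0 then 2 * x.1 j / (m 1 * ρ) else 0)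
  else
    ((Rmat n m i)ᵀ *ᵥ (x.1 + Smat n m i ρ *ᵥ x.2), Rmat n m i *ᵥ x.2)

/-- Composition `D_{(i_N,ρ_N)} ∘ ⋯ ∘ D_{(i_1,ρ_1)}` along an extended symbolic sequence,
given as the list `[(i_1,ρ_1), …, (i_N,ρ_N)]`. -/
noncomputable def Dcomp (n : ℕ) (m : ℕ → ℝ) :
    List (ℕ × ℝ) → ((Fin n → ℝ) × (Fin n → ℝ)) → ((Fin n → ℝ) × (Fin n → ℝ))
  | [], x => x
  | c :: rest, x => Dcomp n m rest (Dmap n m c.1 c.2 x)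

/-- `Rprod [i_1, …, i_k] = R_{i_k}ᵀ ⋯ R_{i_2}ᵀ R_{i_1}ᵀ`. -/
noncomputable def Rprod (n : ℕ) (m : ℕ → ℝ) : List ℕ → Matrix (Fin n) (Fin n) ℝ
  | [] => 1
  | i :: rest => Rprod n m rest * (Rmat n m i)ᵀ

/-- The neutral space `N(Σ, m)`: vectors `δh` with `Σ_j δh_j = 0` such that for every
prefix of `Σ` ending with a floor collision, the first entry of the corresponding
product `R_{i_k}ᵀ ⋯ R_{i_1}ᵀ δh` vanishes. -/
noncomputable def NeutralSpace (n : ℕ) (m : ℕ → ℝ) (Sl : List ℕ) : Set (Fin n → ℝ) :=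
  {δh | (∑ j, δh j) = 0 ∧
    ∀ p : List ℕ, p <+: Sl → p.getLast? = some 0 →
      ∀ a : Fin n, (a : ℕ) = 0 → (Rprod n m p *ᵥ δh) a = 0}

/-- An admissible mass vector: `m_1 > m_2 > … > m_n > 0` (1-based indexing). -/
def Admissible (n : ℕ) (m : ℕ → ℝ) : Prop :=
  (∀ i : ℕ, 1 ≤ i → i < n → m (i + 1) < m i) ∧ 0 < m n

theorem Admissible.pos {n : ℕ} {m : ℕ → ℝ} (hm : Admissible n m) {i : ℕ} (h1 : 1 ≤ i)
    (hi : i ≤ n) : 0 < m i := by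
  induction hi using Nat.decreasingInduction with
  | self => exact hm.2
  | of_succ k hk ih => exact (ih (by omega)).trans (hm.1 k h1 hk)

theorem Admissible.alphaC_pos {n : ℕ} {m : ℕ → ℝ} (hm : Admissible n m) {i : ℕ} (h1 : 1 ≤ i)
    (hi : i < n) {ρ : ℝ} (hρ : 0 < ρ) : 0 < alphaC m i ρ := by
  have h₁ := hm.pos h1 hi.le
  have h₂ := hm.pos (i := i + 1) (by omega) hi
  have h₃ := sub_pos.2 (hm.1 i h1 hi)
  unfold alphaC
  positivity

theorem Rmat_eq_one_add_vecMulVec {n : ℕ} (m : ℕ → ℝ) {i : ℕ} {a b : Fin n}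
    (ha : (a : ℕ) + 1 = i) (hb : (b : ℕ) = i) :
    Rmat n m i = 1 + vecMulVec ((gammaC m i - 1) • Pi.single a 1 + (1 + gammaC m i) • Pi.single b 1)
      (Pi.single a 1 - Pi.single b 1 : Fin n → ℝ) := by
  ext x y
  simp only [Rmat, show i ≠ 0 by omega, if_false, of_apply, Matrix.add_apply, one_apply,
    vecMulVec_apply, Pi.add_apply, Pi.sub_apply, Pi.smul_apply, Pi.single_apply, smul_eq_mul,
    Fin.ext_iff]
  split_ifs <;> first | omega | ring

theorem Smat_eq_smul_vecMulVec {n : ℕ} (m : ℕ → ℝ) (ρ : ℝ) {i : ℕ} {a b : Fin n}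
    (ha : (a : ℕ) + 1 = i) (hb : (b : ℕ) = i) :
    Smat n m i ρ = alphaC m i ρ • vecMulVec (Pi.single a 1 - Pi.single b 1)
      (Pi.single a 1 - Pi.single b 1 : Fin n → ℝ) := by
  ext x y
  simp only [Smat, show i ≠ 0 by omega, if_false, of_apply, Matrix.smul_apply,
    vecMulVec_apply, Pi.sub_apply, Pi.single_apply, smul_eq_mul, Fin.ext_iff]
  split_ifs <;> first | omega | ring

theorem Rmat_mulVec {n : ℕ} (m : ℕ → ℝ) {i : ℕ} {a b : Fin n}
    (ha : (a : ℕ) + 1 = i) (hb : (b : ℕ) = i) (v : Fin n → ℝ) :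
    Rmat n m i *ᵥ v = v + (v a - v b) •
      ((gammaC m i - 1) • Pi.single a 1 + (1 + gammaC m i) • Pi.single b 1) := by
  rw [Rmat_eq_one_add_vecMulVec m ha hb, add_mulVec, one_mulVec, vecMulVec_mulVec, op_smul_eq_smul]
  simp [sub_dotProduct]

theorem Smat_mulVec {n : ℕ} (m : ℕ → ℝ) (ρ : ℝ) {i : ℕ} {a b : Fin n}
    (ha : (a : ℕ) + 1 = i) (hb : (b : ℕ) = i) (v : Fin n → ℝ) :
    Smat n m i ρ *ᵥ v =
      (alphaC m i ρ * (v a - v b)) • (Pi.single a 1 - Pi.single b 1 : Fin n → ℝ) := by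
  rw [Smat_eq_smul_vecMulVec m ρ ha hb, smul_mulVec, vecMulVec_mulVec, op_smul_eq_smul]
  simp [sub_dotProduct, mul_smul]

theorem Rmat_mulVec_Rmat_mulVec {n : ℕ} (m : ℕ → ℝ) {i : ℕ} {a b : Fin n}
    (ha : (a : ℕ) + 1 = i) (hb : (b : ℕ) = i) (v : Fin n → ℝ) :
    Rmat n m i *ᵥ (Rmat n m i *ᵥ v) = v := by
  have hab : a ≠ b := fun h => by subst h; omega
  simp only [Rmat_mulVec m ha hb]
  ext x
  simp [hab, hab.symm]
  ring

theorem Qform_Dmap_zero {n : ℕ} (hn : 0 < n) (m : ℕ → ℝ) (ρ : ℝ)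
    (x : (Fin n → ℝ) × (Fin n → ℝ)) :
    Qform n (Dmap n m 0 ρ x) = Qform n x + 2 * x.1 ⟨0, hn⟩ ^ 2 / (m 1 * ρ) := by
  have h0 : ∀ j : Fin n, (j : ℕ) = 0 ↔ j = ⟨0, hn⟩ := fun j => by simp [Fin.ext_iff]
  simp only [Qform, Dmap, if_true, mul_add, Finset.sum_add_distrib, h0, mul_ite, mul_zero,
    Finset.sum_ite_eq', Finset.mem_univ]
  ring

theorem Qform_Dmap_ball {n : ℕ} (m : ℕ → ℝ) (ρ : ℝ) {i : ℕ} {a b : Fin n}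
    (ha : (a : ℕ) + 1 = i) (hb : (b : ℕ) = i) (x : (Fin n → ℝ) × (Fin n → ℝ)) :
    Qform n (Dmap n m i ρ x) = Qform n x + alphaC m i ρ * (x.2 a - x.2 b) ^ 2 := by
  have hQ : ∀ y, Qform n y = y.1 ⬝ᵥ y.2 := fun _ => rfl
  simp only [hQ, Dmap, show i ≠ 0 by omega, if_false]
  rw [mulVec_transpose, ← dotProduct_mulVec, Rmat_mulVec_Rmat_mulVec m ha hb,
    Smat_mulVec m ρ ha hb, add_dotProduct]
  simp [sub_dotProduct]
  ring

theorem Dmap_zero_left {n : ℕ} (m : ℕ → ℝ) (ρ : ℝ) (v : Fin n → ℝ) :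
    Dmap n m 0 ρ (0, v) = (0, v) := by
  simp [Dmap]

theorem Dmap_ball_of_eq {n : ℕ} (m : ℕ → ℝ) (ρ : ℝ) {i : ℕ} {a b : Fin n}
    (ha : (a : ℕ) + 1 = i) (hb : (b : ℕ) = i) {v : Fin n → ℝ} (hv : v a = v b) :
    Dmap n m i ρ (0, v) = (0, v) := by
  simp [Dmap, show i ≠ 0 by omega, Rmat_mulVec m ha hb, Smat_mulVec m ρ ha hb, hv]

theorem Qform_le_Qform_Dmap {n : ℕ} (hn : 2 ≤ n) {m : ℕ → ℝ} (hm : Admissible n m) {i : ℕ}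
    (hi : i ≤ n - 1) {ρ : ℝ} (hρ : 0 < ρ) (x : (Fin n → ℝ) × (Fin n → ℝ)) :
    Qform n x ≤ Qform n (Dmap n m i ρ x) := by
  rcases Nat.eq_zero_or_pos i with rfl | hpos
  · have := hm.pos (i := 1) le_rfl (by omega)
    rw [Qform_Dmap_zero (by omega)]
    exact le_add_of_nonneg_right (by positivity)
  · have := hm.alphaC_pos hpos (by omega) hρ
    rw [Qform_Dmap_ball m ρ (a := ⟨i - 1, by omega⟩) (b := ⟨i, by omega⟩)
      (Nat.sub_add_cancel hpos) rfl]
    exact le_add_of_nonneg_right (by positivity)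

theorem Qform_le_Qform_Dcomp {n : ℕ} (hn : 2 ≤ n) {m : ℕ → ℝ} (hm : Admissible n m)
    {L : List (ℕ × ℝ)} (hL : ∀ c ∈ L, c.1 ≤ n - 1 ∧ 0 < c.2) (x : (Fin n → ℝ) × (Fin n → ℝ)) :
    Qform n x ≤ Qform n (Dcomp n m L x) := by
  induction L generalizing x with
  | nil => exact le_rfl
  | cons c L ih =>
    have hc := hL c List.mem_cons_self
    exact (Qform_le_Qform_Dmap hn hm hc.1 hc.2 x).trans
      (ih (fun d hd => hL d (List.mem_cons_of_mem c hd)) _)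

theorem eq_of_Qform_Dcomp_nonpos {n : ℕ} (hn : 2 ≤ n) {m : ℕ → ℝ} (hm : Admissible n m)
    {L : List (ℕ × ℝ)} (hL : ∀ c ∈ L, c.1 ≤ n - 1 ∧ 0 < c.2) {v : Fin n → ℝ}
    (hQ : Qform n (Dcomp n m L (0, v)) ≤ 0) {c : ℕ × ℝ} (hc : c ∈ L) {a b : Fin n}
    (ha : (a : ℕ) + 1 = c.1) (hb : (b : ℕ) = c.1) : v a = v b := by
  induction L with
  | nil => simp at hc
  | cons d L ih =>
    obtain ⟨i, ρ⟩ := d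
    obtain ⟨hi, hρ⟩ : i ≤ n - 1 ∧ 0 < ρ := hL (i, ρ) List.mem_cons_self
    have hL' : ∀ c ∈ L, c.1 ≤ n - 1 ∧ 0 < c.2 := fun e he => hL e (List.mem_cons_of_mem _ he)
    simp only [Dcomp] at hQ
    rcases Nat.eq_zero_or_pos i with rfl | hpos
    · rw [Dmap_zero_left] at hQ
      rcases List.mem_cons.1 hc with rfl | hc
      · simp at ha
      · exact ih hL' hQ hc
    · obtain ⟨p, hp⟩ : ∃ p : Fin n, (p : ℕ) + 1 = i := ⟨⟨i - 1, by omega⟩, Nat.sub_add_cancel hpos⟩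
      obtain ⟨q, hq⟩ : ∃ q : Fin n, (q : ℕ) = i := ⟨⟨i, by omega⟩, rfl⟩
      have hα := hm.alphaC_pos hpos (by omega) hρ
      have hle := (Qform_le_Qform_Dcomp hn hm hL' _).trans hQ
      rw [Qform_Dmap_ball m ρ hp hq] at hle
      have hv : v p = v q := by
        by_contra hne
        have : 0 < alphaC m i ρ * (v p - v q) ^ 2 :=
          mul_pos hα (by have := sub_ne_zero.2 hne; positivity)
        simp [Qform] at hle
        linarith
      rcases List.mem_cons.1 hc with rfl | hc
      · rwa [show a = p from Fin.ext (Nat.succ_injective (ha.trans hp.symm)),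
          show b = q from Fin.ext (hb.trans hq.symm)]
      · rw [Dmap_ball_of_eq m ρ hp hq hv] at hQ
        exact ih hL' hQ hc

/-- If all ball-to-ball collision types `(i, i+1)`, `1 ≤ i ≤ n-1`,
occur in the sequence, then every nonzero `(0, δv)` with `Σ_j δv_j = 0` gets strictly
positive `Q₁` after the composition of the collision maps. -/
theorem property_A (n : ℕ) (hn : 2 ≤ n) (m : ℕ → ℝ) (hm : Admissible n m)
    (L : List (ℕ × ℝ)) (hL : ∀ c ∈ L, c.1 ≤ n - 1 ∧ 0 < c.2)
    (hall : ∀ i : ℕ, 1 ≤ i → i ≤ n - 1 → ∃ ρ : ℝ, (i, ρ) ∈ L) :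
    ∀ δv : Fin n → ℝ, (∑ j, δv j) = 0 → δv ≠ 0 →
      0 < Qform n (Dcomp n m L (0, δv)) := by
  intro v hsum hne
  by_contra! hQ
  have hconst : ∀ k (hk : k < n), v ⟨k, hk⟩ = v ⟨0, by omega⟩ := by
    intro k
    induction k with
    | zero => intro _; rfl
    | succ k ih =>
      intro hk
      obtain ⟨ρ, hρ⟩ := hall (k + 1) (by omega) (by omega)
      rw [← ih (by omega)]
      exact (eq_of_Qform_Dcomp_nonpos hn hm hL hQ hρ rfl rfl).symm
  have hconst' : ∀ j, v j = v ⟨0, by omega⟩ := fun j => hconst j j.2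
  apply hne
  ext j
  rw [Finset.sum_congr rfl fun j _ => hconst' j] at hsum
  rw [hconst' j]
  simpa [show n ≠ 0 by omega] using hsum
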